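/- arXiv:2503.05013 — 3 statements merged into one kernel-verified Lean document; each statement's English description precedes it below -/
import Mathlib

section
/- For all non-negative integers n, a and j with j ≤ n, the following identity holds: binom(2n-j,j) * Σ_{v=0}^{2n-2j} binom(2n-2j,v) * (-1)^{j+v} * binom(a+j+v,a) * binom(a+2n-j-v,a) = (-1)^n * binom(a+n,a) * binom(a+j,j) * binom(a,n-j). -/
/-- The ratio of consecutive binomial coefficients `(a + c).choose a` in `c`. -/
lemma cast_choose_add_succ (a c : ℕ) :
    ((a + c + 1).choose a : ℚ) = (a + c + 1) * (a + c).choose a / (c + 1) := by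
  have h := Nat.choose_mul_succ_eq (a + c) a
  rw [show a + c + 1 - a = c + 1 by omega] at h
  have h' : ((a + c).choose a : ℚ) * (a + c + 1) = (a + c + 1).choose a * (c + 1) := by
    exact_mod_cast h
  rw [eq_div_iff (by positivity)]
  linarith

/-- The ratio of consecutive binomial coefficients `a.choose m` in `m`. -/
lemma cast_choose_succ_right (a m : ℕ) :
    (a.choose (m + 1) : ℚ) * (m + 1) = a.choose m * (a - m) := by
  rcases le_or_gt m a with h | h
  · have := Nat.choose_succ_right_eq a m
    rw [← Nat.cast_sub h]
    exact_mod_cast this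
  · simp [Nat.choose_eq_zero_of_lt h, Nat.choose_eq_zero_of_lt (Nat.lt_succ_of_lt h)]

/-- The summand of the alternating Dixon-type sum. -/
def dixonTerm (a j N v : ℕ) : ℚ :=
  (-1) ^ v * N.choose v * (a + (j + v)).choose a * (a + (j + (N - v))).choose a

/-- The telescoping certificate for the recurrence satisfied by the sums of `dixonTerm`. -/
def dixonCertificate (a j m v : ℕ) : ℚ :=
  ((a + j + 2 * m + 2) * (j + m + 1) * (2 * m + j + 1) +
    (a + j + m + 1) * v * (2 * m + 1 - v)) * dixonTerm a j (2 * m + 1) v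

lemma dixonCertificate_succ_sub (a j m k l : ℕ) (h : 2 * m = k + l) :
    (j + m + 1) * (2 * m + j + 2) * (2 * m + j + 1) * dixonTerm a j (2 * m + 2) (k + 1) +
        2 * (2 * m + 1) * (a + j + m + 1) * (a - m) * dixonTerm a j (2 * m) k =
      dixonCertificate a j m (k + 1) - dixonCertificate a j m k := by
  have hm : (m : ℚ) = (k + l) / 2 := by
    have : (2 * m : ℚ) = k + l := by exact_mod_cast h
    linarith
  unfold dixonCertificate dixonTerm
  rw [hm, h, show k + l + 2 - (k + 1) = l + 1 by omega, show k + l - k = l by omega,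
    show k + l + 1 - (k + 1) = l by omega, show k + l + 1 - k = l + 1 by omega]
  have e1 := cast_choose_add_succ a (j + k)
  have e2 := cast_choose_add_succ a (j + l)
  have e3 := cast_choose_add_succ k l
  have e4 : ((k + l + 1).choose (k + 1) : ℚ) = (k + l + 1) * (k + l).choose k / (k + 1) := by
    rw [eq_div_iff (by positivity)]
    exact_mod_cast (Nat.add_one_mul_choose_eq (k + l) k).symm
  have e5 : ((k + l + 2).choose (k + 1) : ℚ) =
      (k + l + 2) * (k + l + 1).choose k / (k + 1) := by
    rw [eq_div_iff (by positivity)]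
    exact_mod_cast (Nat.add_one_mul_choose_eq (k + l + 1) k).symm
  simp only [← add_assoc] at e1 e2 ⊢
  rw [e1, e2, e5, e4, e3]
  push_cast
  field_simp
  ring

lemma sum_dixonTerm_partial (a j m k : ℕ) (hk : k ≤ 2 * m + 1) :
    (j + m + 1) * (2 * m + j + 2) * (2 * m + j + 1) *
          ∑ v ∈ Finset.range (k + 1), dixonTerm a j (2 * m + 2) v +
        2 * (2 * m + 1) * (a + j + m + 1) * (a - m) *
          ∑ v ∈ Finset.range k, dixonTerm a j (2 * m) v =
      dixonCertificate a j m k := by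
  induction k with
  | zero =>
    have e := cast_choose_add_succ a (j + (2 * m + 1))
    simp only [← add_assoc] at e
    simp only [dixonCertificate, dixonTerm, ← add_assoc, zero_add, Finset.sum_range_one,
      Finset.sum_range_zero, Nat.sub_zero, Nat.choose_zero_right]
    rw [e]
    push_cast
    field_simp
    ring
  | succ k ih =>
    have h := dixonCertificate_succ_sub a j m k (2 * m - k) (by omega)
    rw [Finset.sum_range_succ _ (k + 1), Finset.sum_range_succ (dixonTerm a j (2 * m)) k]
    linear_combination ih (by omega) + h

lemma sum_dixonTerm_recurrence (a j m : ℕ) :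
    (j + m + 1) * (2 * m + j + 2) * (2 * m + j + 1) *
          ∑ v ∈ Finset.range (2 * m + 3), dixonTerm a j (2 * m + 2) v +
        2 * (2 * m + 1) * (a + j + m + 1) * (a - m) *
          ∑ v ∈ Finset.range (2 * m + 1), dixonTerm a j (2 * m) v = 0 := by
  have h := sum_dixonTerm_partial a j m (2 * m + 1) le_rfl
  have hlast : (j + m + 1) * (2 * m + j + 2) * (2 * m + j + 1) *
      dixonTerm a j (2 * m + 2) (2 * m + 2) = -dixonCertificate a j m (2 * m + 1) := by
    have e := cast_choose_add_succ a (j + (2 * m + 1))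
    simp only [← add_assoc] at e
    simp only [dixonCertificate, dixonTerm, ← add_assoc, Nat.sub_self, Nat.choose_self]
    rw [e]
    push_cast
    field_simp
    ring
  rw [Finset.sum_range_succ]
  linear_combination h + hlast

/-- A form of Dixon's identity for a terminating well-poised alternating sum. -/
lemma choose_mul_sum_dixonTerm (a j m : ℕ) :
    ((j + 2 * m).choose j : ℚ) * ∑ v ∈ Finset.range (2 * m + 1), dixonTerm a j (2 * m) v =
      (-1) ^ m * (a + (j + m)).choose a * (a + j).choose j * a.choose m := by
  induction m with
  | zero =>
    have e : (a + j).choose a = (a + j).choose j := Nat.choose_symm_add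
    simp [dixonTerm, e]
  | succ m ih =>
    have hrec := sum_dixonTerm_recurrence a j m
    have e1 := cast_choose_add_succ j (2 * m)
    have e2 := cast_choose_add_succ j (2 * m + 1)
    have e3 := cast_choose_add_succ a (j + m)
    have e4 : (a.choose (m + 1) : ℚ) = a.choose m * (a - m) / (m + 1) :=
      (eq_div_iff (by positivity)).2 (cast_choose_succ_right a m)
    simp only [← add_assoc, mul_add, mul_one] at ih e1 e2 e3 ⊢
    set S := ∑ v ∈ Finset.range (2 * m + 1), dixonTerm a j (2 * m) v
    have hS : ∑ v ∈ Finset.range (2 * m + 2 + 1), dixonTerm a j (2 * m + 2) v =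
        -(2 * (2 * m + 1) * (a + j + m + 1) * (a - m) * S) /
          ((j + m + 1) * (2 * m + j + 2) * (2 * m + j + 1)) := by
      rw [eq_div_iff (by positivity)]
      linear_combination hrec
    rw [hS, show j + 2 * m + 2 = j + 2 * m + 1 + 1 from rfl, e2, e1, e3, e4, pow_succ]
    push_cast
    field_simp
    linear_combination
      (-(a + j + m + 1) * (a - m) * (2 * m + 2) * (j + 2 * m + 1) * (j + 2 * m + 2) : ℚ) * ih

theorem stmt17 (n a j : ℕ) (hj : j ≤ n) :
    ((2 * n - j).choose j : ℤ) *
        ∑ v ∈ Finset.range (2 * n - 2 * j + 1),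
          ((2 * n - 2 * j).choose v : ℤ) * (-1) ^ (j + v) *
            ((a + j + v).choose a : ℤ) * ((a + 2 * n - j - v).choose a : ℤ) =
      (-1) ^ n * ((a + n).choose a : ℤ) * ((a + j).choose j : ℤ) *
        (a.choose (n - j) : ℤ) := by
  obtain ⟨m, rfl⟩ := Nat.exists_eq_add_of_le hj
  have h := choose_mul_sum_dixonTerm a j m
  have hsum : ((∑ v ∈ Finset.range (2 * m + 1), ((2 * m).choose v : ℤ) * (-1) ^ (j + v) *
      ((a + j + v).choose a : ℤ) * ((a + 2 * (j + m) - j - v).choose a : ℤ) : ℤ) : ℚ) =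
      (-1) ^ j * ∑ v ∈ Finset.range (2 * m + 1), dixonTerm a j (2 * m) v := by
    push_cast
    rw [Finset.mul_sum]
    refine Finset.sum_congr rfl fun v hv => ?_
    have hv' := Finset.mem_range.1 hv
    rw [show a + 2 * (j + m) - j - v = a + (j + (2 * m - v)) by omega, dixonTerm, add_assoc]
    ring
  rw [show 2 * (j + m) - j = j + 2 * m by omega, show 2 * (j + m) - 2 * j = 2 * m by omega,
    Nat.add_sub_cancel_left, ← Int.cast_inj (α := ℚ), Int.cast_mul, hsum]
  push_cast
  rw [pow_add]
  linear_combination (-1) ^ j * h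
end

section
/- For all non-negative integers n, a and j with j ≤ n, the following identity holds: binom(2n-j,j) * Σ_{v=0}^{2n-2j} binom(2n-2j,v) * binom(2n,j+v) * (-1)^{j+v} * binom(a+j+v,a) * binom(a+2n-j-v,a) = (-1)^n * binom(2n,n) * Σ_{u=0}^{n-j} binom(n,j+u) * binom(j+u,u) * binom(a+j+u,j+u) * binom(a+n,2n-j-u). -/
section

open Polynomial

/-- The von Szily identity, with the sum written as a coefficient. -/
theorem coeff_one_sub_X_pow_mul_one_add_X_pow (p q : ℕ) :
    ((1 - X : ℤ[X]) ^ (2 * p) * (1 + X) ^ (2 * q)).coeff (p + q) *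
      ((p.factorial * q.factorial * (p + q).factorial : ℕ) : ℤ) =
      (-1) ^ p * (((2 * p).factorial * (2 * q).factorial : ℕ) : ℤ) := by
  induction p generalizing q with
  | zero =>
    have h : (2 * q).choose q * (q.factorial * q.factorial) = (2 * q).factorial := by
      have := Nat.add_choose_mul_factorial_mul_factorial q q
      rw [two_mul, ← this]; ring
    simp [coeff_one_add_X_pow]
    exact_mod_cast h
  | succ p ih =>
    have e : ((1 - X : ℤ[X]) ^ (2 * (p + 1)) * (1 + X) ^ (2 * q)) =
        (1 - X) ^ (2 * p) * (1 + X) ^ (2 * (q + 1)) -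
          C 4 * ((1 - X) ^ (2 * p) * (1 + X) ^ (2 * q)) * X := by
      have : (C 4 : ℤ[X]) = 4 := rfl
      rw [this]; ring
    have h1 := ih q
    have h2 := ih (q + 1)
    rw [e, coeff_sub, show p + 1 + q = p + q + 1 by ring, coeff_mul_X, coeff_C_mul]
    rw [← add_assoc] at h2
    simp only [show 2 * (p + 1) = 2 * p + 1 + 1 by ring, show 2 * (q + 1) = 2 * q + 1 + 1 by ring,
      Nat.factorial_succ] at h2 ⊢
    push_cast at h1 h2 ⊢
    apply mul_right_cancel₀ (b := (q + 1 : ℤ)) (by positivity)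
    linear_combination (p + 1 : ℤ) * h2 - 4 * (p+1) * (p + q + 1) * (q+1) * h1

theorem coeff_one_sub_X_pow (m k : ℕ) :
    ((1 - X : ℤ[X]) ^ m).coeff k = (-1) ^ k * (m.choose k : ℤ) := by
  have : (1 - X : ℤ[X]) ^ m = ((1 + X) ^ m).comp (C (-1) * X) := by
    simp [sub_eq_add_neg]
  rw [this, comp_C_mul_X_coeff, coeff_one_add_X_pow, mul_comm]

theorem sum_range_eq_sum_range {M : Type*} [AddCommMonoid M] {f : ℕ → M} {m n : ℕ}
    (h₁ : ∀ i, m ≤ i → i < n → f i = 0) (h₂ : ∀ i, n ≤ i → i < m → f i = 0) :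
    ∑ i ∈ Finset.range m, f i = ∑ i ∈ Finset.range n, f i := by
  rcases le_total m n with h | h
  · exact Finset.sum_subset (by simpa using h) fun i hi hi' =>
      h₁ i (by simpa using hi') (by simpa using hi)
  · exact (Finset.sum_subset (by simpa using h) fun i hi hi' =>
      h₂ i (by simpa using hi') (by simpa using hi)).symm

theorem sum_choose_mul_choose_add (m b c : ℕ) :
    ∑ i ∈ Finset.range (m + 1), m.choose i * b.choose (c + i) = (m + b).choose (m + c) := by
  rw [Nat.add_choose_eq, Finset.Nat.sum_antidiagonal_eq_sum_range_succ_mk]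
  rw [← Finset.sum_range_reflect]
  symm
  rw [← Finset.sum_subset (s₁ := Finset.range (m + 1))]
  · refine Finset.sum_congr rfl fun i hi => ?_
    have hi : i ≤ m := by simpa [Nat.lt_succ_iff] using hi
    rw [show m + 1 - 1 - i = m - i by omega, Nat.choose_symm hi, show m + c - i = c + (m - i) by omega]
  · intro i; simp; omega
  · intro i _ h; simp at h; simp [Nat.choose_eq_zero_of_lt h]

theorem sum_choose_mul_choose_of_le (m b n : ℕ) (h : m ≤ n) :
    ∑ i ∈ Finset.range (n + 1), m.choose i * b.choose i = (m + b).choose m := by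
  have e := sum_choose_mul_choose_add m b 0
  simp only [zero_add, add_zero] at e
  rw [← e]
  refine sum_range_eq_sum_range (fun i _ _ => ?_) fun i _ _ => ?_
  · omega
  · simp [Nat.choose_eq_zero_of_lt (show m < i by omega)]

theorem sum_choose_mul_choose_mul_choose_add (m i b c : ℕ) (hi : i ≤ m) :
    ∑ s ∈ Finset.range (m + 1), m.choose s * s.choose i * b.choose (c + s) =
      m.choose i * (m - i + b).choose (m + c) := by
  obtain ⟨d, rfl⟩ := Nat.exists_eq_add_of_le hi
  have := sum_choose_mul_choose_add d b (i + c)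
  rw [show i + d - i = d by omega, show i + d + c = d + (i + c) by ring, ← this, add_assoc i d 1,
    Finset.sum_range_add, Finset.sum_eq_zero, zero_add, Finset.mul_sum]
  · refine Finset.sum_congr rfl fun s hs => ?_
    rw [Nat.choose_mul (by omega)]
    rw [show i + d - i = d by omega, show i + s - i = s by omega]
    rw [show c + (i + s) = i + c + s by ring]; ring
  · intro s hs; simp at hs; simp [Nat.choose_eq_zero_of_lt hs]

theorem choose_mul_choose_mul_choose_eq_sum (a k l : ℕ) :
    (k + l).choose k * (a + k).choose a * (a + l).choose a =
      ∑ i ∈ Finset.range (a + 1), a.choose i * (a + (k + l) - i).choose a *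
        ((k + l - i).choose k * k.choose i) := by
  have h : ∀ i ∈ Finset.range (a + 1), a.choose i * (a + (k + l) - i).choose a *
        ((k + l - i).choose k * k.choose i) = (a + k).choose a *
        ∑ m ∈ Finset.range (a + 1), a.choose m * m.choose i * (k + l).choose (k + m) * k.choose i := by
    intro i hi
    have hi : i ≤ a := by simpa [Nat.lt_succ_iff] using hi
    rw [← Finset.sum_mul, sum_choose_mul_choose_mul_choose_add _ _ _ _ hi]
    rcases lt_or_ge k i with h | h
    · simp [Nat.choose_eq_zero_of_lt h]
    rw [show a - i + (k + l) = a + (k + l - i) by omega,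
      show a + (k + l) - i = a + (k + l - i) by omega]
    generalize k + l - i = t
    rcases lt_or_ge t k with h | h
    · simp [Nat.choose_eq_zero_of_lt h, Nat.choose_eq_zero_of_lt (Nat.add_lt_add_left h a)]
    have := Nat.choose_mul (n := a + t) (k := a + k) (s := a) (by omega)
    rw [show a + t - a = t by omega, show a + k - a = k by omega] at this
    linear_combination (a.choose i * k.choose i) * this.symm
  rw [Finset.sum_congr rfl h, ← Finset.mul_sum, Finset.sum_comm]
  have h2 : ∀ m ∈ Finset.range (a + 1), ∑ i ∈ Finset.range (a + 1),
      a.choose m * m.choose i * (k + l).choose (k + m) * k.choose i =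
      (k + l).choose k * (a.choose m * l.choose (0 + m)) := by
    intro m hm
    have hm : m ≤ a := by simpa [Nat.lt_succ_iff] using hm
    have : ∀ i, a.choose m * m.choose i * (k + l).choose (k + m) * k.choose i =
      a.choose m * (k + l).choose (k + m) * (m.choose i * k.choose i) := by
      intro i; ring
    simp only [this]
    rw [← Finset.mul_sum, sum_choose_mul_choose_of_le _ _ _ hm]
    rcases lt_or_ge l m with h | h
    · simp [Nat.choose_eq_zero_of_lt h, Nat.choose_eq_zero_of_lt (Nat.add_lt_add_left h k)]
    have := Nat.choose_mul (n := k + l) (k := k + m) (s := k) (by omega)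
    rw [show k + l - k = l by omega, show k + m - k = m by omega, Nat.choose_symm_add] at this
    rw [zero_add, add_comm m k]
    linear_combination a.choose m * this
  rw [Finset.sum_congr rfl h2, ← Finset.mul_sum, sum_choose_mul_choose_add, add_zero]
  ring

theorem choose_mul_sum_alternating (n j i : ℕ) (hj : j ≤ n) (hi : i ≤ n) :
    ((2 * n - j).choose j : ℤ) * ∑ v ∈ Finset.range (2 * n - 2 * j + 1),
      ((2 * n - 2 * j).choose v : ℤ) * (-1) ^ (j + v) *
        (((2 * n - i).choose (j + v) * (j + v).choose i : ℕ) : ℤ) =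
      (-1) ^ n * (((2 * n - j).choose n * (n.choose i * (2 * n - i).choose j) : ℕ) : ℤ) := by
  obtain ⟨p, hp⟩ := Nat.exists_eq_add_of_le hj
  obtain ⟨q, hq⟩ := Nat.exists_eq_add_of_le hi
  have hsum : ∑ v ∈ Finset.range (2 * n - 2 * j + 1),
      ((2 * n - 2 * j).choose v : ℤ) * (-1) ^ (j + v) *
        (((2 * n - i).choose (j + v) * (j + v).choose i : ℕ) : ℤ) =
      (-1) ^ j * ((2 * n - i).choose i : ℤ) *
        ((1 - X : ℤ[X]) ^ (2 * p) * (1 + X) ^ (2 * q)).coeff (p + q) := by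
    rw [coeff_mul, Finset.Nat.sum_antidiagonal_eq_sum_range_succ_mk, Finset.mul_sum,
      show 2 * n - 2 * j = 2 * p by omega,
      sum_range_eq_sum_range (n := p + q + 1)]
    · refine Finset.sum_congr rfl fun v hv => ?_
      have hv : v ≤ p + q := by simpa [Nat.lt_succ_iff] using hv
      rw [coeff_one_sub_X_pow, coeff_one_add_X_pow]
      have : (2 * n - i).choose (j + v) * (j + v).choose i =
          (2 * n - i).choose i * (2 * q).choose (p + q - v) := by
        rcases lt_or_ge (j + v) i with h | h
        · simp [Nat.choose_eq_zero_of_lt h,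
            Nat.choose_eq_zero_of_lt (show 2 * q < p + q - v by omega)]
        · rw [Nat.choose_mul h, show 2 * n - i - i = 2 * q by omega,
            ← Nat.choose_symm (show j + v - i ≤ 2 * q by omega),
            show 2 * q - (j + v - i) = p + q - v by omega]
      rw [this]
      push_cast
      ring
    · intro v h _
      simp [Nat.choose_eq_zero_of_lt (show 2 * p < v by omega)]
    · intro v h _
      simp [Nat.choose_eq_zero_of_lt (show 2 * n - i < j + v by omega)]
  rw [hsum]
  have hs := coeff_one_sub_X_pow_mul_one_add_X_pow p q
  generalize ((1 - X : ℤ[X]) ^ (2 * p) * (1 + X) ^ (2 * q)).coeff (p + q) = c at hs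
  have hs : (c : ℚ) * ((p.factorial * q.factorial * (p + q).factorial : ℕ) : ℚ) =
      (-1) ^ p * (((2 * p).factorial * (2 * q).factorial : ℕ) : ℚ) := by exact_mod_cast hs
  suffices h : ((2 * n - j).choose j : ℚ) * ((-1) ^ j * ((2 * n - i).choose i : ℚ) * c) =
      (-1) ^ n * (((2 * n - j).choose n * (n.choose i * (2 * n - i).choose j) : ℕ) : ℚ) by
    exact_mod_cast h
  push_cast at hs ⊢
  rw [Nat.cast_choose ℚ (show j ≤ 2 * n - j by omega), Nat.cast_choose ℚ (show i ≤ 2 * n - i by omega),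
    Nat.cast_choose ℚ (show n ≤ 2 * n - j by omega), Nat.cast_choose ℚ hi,
    Nat.cast_choose ℚ (show j ≤ 2 * n - i by omega), show 2 * n - j - j = 2 * p by omega,
    show 2 * n - i - i = 2 * q by omega, show 2 * n - j - n = p by omega,
    show n - i = q by omega, show 2 * n - i - j = p + q by omega]
  have hpow : (-1 : ℚ) ^ n = (-1) ^ j * (-1) ^ p := by rw [hp, pow_add]
  rw [hpow]
  have hc : (c : ℚ) = (-1) ^ p * ((2 * p).factorial * (2 * q).factorial) /
      (p.factorial * q.factorial * (p + q).factorial) := by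
    rw [eq_div_iff (by positivity)]; exact hs
  rw [hc]
  field_simp

end

theorem choose_mul_sum_left (n a j : ℕ) (hj : j ≤ n) :
    (a + j).factorial * (2 * n - j).factorial * ((2 * n - j).choose n *
      ∑ i ∈ Finset.range (n + 1), n.choose i * a.choose i * (a + 2 * n - i).choose (a + j)) =
    a.factorial * (2 * n).factorial * ((a + n).choose n *
      ∑ s ∈ Finset.range (n + 1), n.choose s * a.choose s * (2 * n - j + s).choose (n - j)) := by
  have h : (a + j).factorial * (2 * n - j).factorial *
      ∑ i ∈ Finset.range (n + 1), n.choose i * a.choose i * (a + 2 * n - i).choose (a + j) =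
      a.factorial * (2 * n).factorial *
      ∑ i ∈ Finset.range (n + 1), ∑ s ∈ Finset.range (n + 1),
        n.choose s * s.choose i * (a + n).choose (n + s) * (2 * n - j).choose i := by
    rw [Finset.mul_sum, Finset.mul_sum]
    refine Finset.sum_congr rfl fun i hi => ?_
    have hi : i ≤ n := by simpa [Nat.lt_succ_iff] using hi
    rw [← Finset.sum_mul, sum_choose_mul_choose_mul_choose_add _ _ _ _ hi,
      show n - i + (a + n) = a + 2 * n - i by omega, ← two_mul]
    rcases lt_or_ge a i with h | h
    · simp [Nat.choose_eq_zero_of_lt h,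
        Nat.choose_eq_zero_of_lt (show a + 2 * n - i < 2 * n by omega)]
    have h' : i ≤ 2 * n - j := by omega
    qify
    rw [Nat.cast_choose ℚ h, Nat.cast_choose ℚ h',
      Nat.cast_choose ℚ (show a + j ≤ a + 2 * n - i by omega),
      Nat.cast_choose ℚ (show 2 * n ≤ a + 2 * n - i by omega),
      show a + 2 * n - i - (a + j) = 2 * n - j - i by omega,
      show a + 2 * n - i - 2 * n = a - i by omega]
    field_simp
  rw [mul_left_comm, h, mul_left_comm, Finset.sum_comm]
  congr 1
  rw [Finset.mul_sum, Finset.mul_sum]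
  refine Finset.sum_congr rfl fun s hs => ?_
  have hs : s ≤ n := by simpa [Nat.lt_succ_iff] using hs
  have e : ∀ i, n.choose s * s.choose i * (a + n).choose (n + s) * (2 * n - j).choose i =
      n.choose s * (a + n).choose (n + s) * (s.choose i * (2 * n - j).choose i) := by
    intro i; ring
  simp only [e]
  rw [← Finset.mul_sum, sum_choose_mul_choose_of_le _ _ _ hs]
  rcases lt_or_ge a s with h | h
  · simp [Nat.choose_eq_zero_of_lt h, Nat.choose_eq_zero_of_lt (show a + n < n + s by omega)]
  qify
  rw [Nat.cast_choose ℚ h, Nat.cast_choose ℚ (show n ≤ 2 * n - j by omega),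
    Nat.cast_choose ℚ (show n + s ≤ a + n by omega), Nat.cast_choose ℚ (show n ≤ a + n by omega),
    Nat.cast_choose ℚ (show s ≤ s + (2 * n - j) by omega),
    Nat.cast_choose ℚ (show n - j ≤ 2 * n - j + s by omega),
    show 2 * n - j - n = n - j by omega, show a + n - (n + s) = a - s by omega,
    show a + n - n = a by omega, show s + (2 * n - j) - s = 2 * n - j by omega,
    show 2 * n - j + s - (n - j) = n + s by omega, add_comm s]
  field_simp

theorem choose_mul_sum_right (n a j : ℕ) (hj : j ≤ n) :
    (2 * n - j).choose n * ∑ u ∈ Finset.range (n - j + 1),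
      n.choose (j + u) * (a + j + u).choose (a + j) * (a + n).choose (2 * n - j - u) =
    (a + n).choose (n - j) *
      ∑ s ∈ Finset.range (n + 1), n.choose s * a.choose s * (2 * n - j + s).choose (n - j) := by
  have h : (2 * n - j).choose n * ∑ u ∈ Finset.range (n - j + 1),
      n.choose (j + u) * (a + j + u).choose (a + j) * (a + n).choose (2 * n - j - u) =
      (a + n).choose (n - j) * ∑ u ∈ Finset.range (n - j + 1), ∑ s ∈ Finset.range (n + 1),
        n.choose s * s.choose (n - j - u) * a.choose (0 + s) * (2 * n - j).choose u := by
    rw [Finset.mul_sum, Finset.mul_sum]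
    refine Finset.sum_congr rfl fun u hu => ?_
    have hu : u ≤ n - j := by simpa [Nat.lt_succ_iff] using hu
    rw [← Finset.sum_mul, sum_choose_mul_choose_mul_choose_add _ _ _ _ (by omega),
      show n - (n - j - u) + a = a + j + u by omega, add_zero,
      ← Nat.choose_symm (show n - j - u ≤ n by omega), show n - (n - j - u) = j + u by omega]
    rcases lt_or_ge (a + j + u) n with h | h
    · simp [Nat.choose_eq_zero_of_lt h,
        Nat.choose_eq_zero_of_lt (show a + n < 2 * n - j - u by omega)]
    qify
    rw [Nat.cast_choose ℚ h, Nat.cast_choose ℚ (show n ≤ 2 * n - j by omega),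
      Nat.cast_choose ℚ (show a + j ≤ a + j + u by omega),
      Nat.cast_choose ℚ (show 2 * n - j - u ≤ a + n by omega),
      Nat.cast_choose ℚ (show n - j ≤ a + n by omega),
      Nat.cast_choose ℚ (show u ≤ 2 * n - j by omega),
      show 2 * n - j - n = n - j by omega, show a + j + u - (a + j) = u by omega,
      show a + n - (2 * n - j - u) = a + j + u - n by omega,
      show a + n - (n - j) = a + j by omega]
    field_simp
  rw [h, Finset.sum_comm]
  congr 1
  refine Finset.sum_congr rfl fun s _ => ?_
  rw [Nat.add_choose_eq, Finset.Nat.sum_antidiagonal_eq_sum_range_succ_mk, Finset.mul_sum]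
  refine Finset.sum_congr rfl fun u _ => ?_
  rw [zero_add]
  ring

theorem stmt18 (n a j : ℕ) (hj : j ≤ n) :
    ((2 * n - j).choose j : ℤ) *
        ∑ v ∈ Finset.range (2 * n - 2 * j + 1),
          ((2 * n - 2 * j).choose v : ℤ) * ((2 * n).choose (j + v) : ℤ) *
            (-1) ^ (j + v) * ((a + j + v).choose a : ℤ) *
            ((a + 2 * n - j - v).choose a : ℤ) =
      (-1) ^ n * ((2 * n).choose n : ℤ) *
        ∑ u ∈ Finset.range (n - j + 1),
          ((n.choose (j + u) : ℤ)) * (((j + u).choose u : ℤ)) *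
            ((a + j + u).choose (j + u) : ℤ) * ((a + n).choose (2 * n - j - u) : ℤ) := by
  have hexp : ∀ v ∈ Finset.range (2 * n - 2 * j + 1),
      ((2 * n - 2 * j).choose v : ℤ) * ((2 * n).choose (j + v) : ℤ) *
            (-1) ^ (j + v) * ((a + j + v).choose a : ℤ) *
            ((a + 2 * n - j - v).choose a : ℤ) =
      ∑ i ∈ Finset.range (n + 1), (a.choose i * (a + 2 * n - i).choose a : ℤ) *
        (((2 * n - 2 * j).choose v : ℤ) * (-1) ^ (j + v) *
        (((2 * n - i).choose (j + v) * (j + v).choose i : ℕ) : ℤ)) := by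
    intro v hv
    have hv : v ≤ 2 * n - 2 * j := by simpa [Nat.lt_succ_iff] using hv
    have h := choose_mul_choose_mul_choose_eq_sum a (j + v) (2 * n - j - v)
    rw [show j + v + (2 * n - j - v) = 2 * n by omega,
      show a + (2 * n - j - v) = a + 2 * n - j - v by omega, ← add_assoc,
      sum_range_eq_sum_range (n := n + 1)] at h
    · have h := congrArg (Nat.cast : ℕ → ℤ) h
      push_cast at h
      calc _ = ((2 * n - 2 * j).choose v : ℤ) * (-1) ^ (j + v) *
            ((2 * n).choose (j + v) * (a + j + v).choose a * (a + 2 * n - j - v).choose a : ℤ) := by ring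
        _ = _ := by
            rw [h]
            push_cast
            rw [Finset.mul_sum]
            exact Finset.sum_congr rfl fun i _ => by ring
    · intro i h _
      simp [Nat.choose_eq_zero_of_lt (show a < i by omega)]
    · intro i h _
      rcases lt_or_ge (j + v) i with h' | h'
      · simp [Nat.choose_eq_zero_of_lt h']
      · simp [Nat.choose_eq_zero_of_lt (show 2 * n - i < j + v by omega)]
  have hL : ((2 * n - j).choose j : ℤ) *
        ∑ v ∈ Finset.range (2 * n - 2 * j + 1),
          ((2 * n - 2 * j).choose v : ℤ) * ((2 * n).choose (j + v) : ℤ) *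
            (-1) ^ (j + v) * ((a + j + v).choose a : ℤ) *
            ((a + 2 * n - j - v).choose a : ℤ) =
      (-1) ^ n * (((2 * n - j).choose n * ((a + j).choose j *
        ∑ i ∈ Finset.range (n + 1), n.choose i * a.choose i * (a + 2 * n - i).choose (a + j) :
          ℕ) : ℕ) : ℤ) := by
    rw [Finset.sum_congr rfl hexp, Finset.sum_comm, Finset.mul_sum]
    rw [Nat.cast_mul, Nat.cast_mul, Nat.cast_sum]
    simp only [Finset.mul_sum]
    refine Finset.sum_congr rfl fun i hi => ?_
    have hi : i ≤ n := by simpa [Nat.lt_succ_iff] using hi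
    rw [← Finset.mul_sum, ← Finset.mul_sum, mul_left_comm, choose_mul_sum_alternating n j i hj hi]
    have : (a + 2 * n - i).choose a * (2 * n - i).choose j =
        (a + j).choose j * (a + 2 * n - i).choose (a + j) := by
      have := Nat.choose_mul (n := a + 2 * n - i) (k := a + j) (s := a) (by omega)
      rw [show a + 2 * n - i - a = 2 * n - i by omega, Nat.add_sub_cancel_left,
        Nat.choose_symm_add] at this
      rw [← this, mul_comm]
    have : ((a + 2 * n - i).choose a * (2 * n - i).choose j : ℤ) =
        (a + j).choose j * (a + 2 * n - i).choose (a + j) := by exact_mod_cast this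
    push_cast
    linear_combination (-1) ^ n * ((2 * n - j).choose n : ℤ) * n.choose i * a.choose i * this
  have hR : ∑ u ∈ Finset.range (n - j + 1),
          ((n.choose (j + u) : ℤ)) * (((j + u).choose u : ℤ)) *
            ((a + j + u).choose (j + u) : ℤ) * ((a + n).choose (2 * n - j - u) : ℤ) =
      (((a + j).choose j * ∑ u ∈ Finset.range (n - j + 1),
      n.choose (j + u) * (a + j + u).choose (a + j) * (a + n).choose (2 * n - j - u) : ℕ) : ℤ) := by
    push_cast
    rw [Finset.mul_sum]
    refine Finset.sum_congr rfl fun u _ => ?_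
    have : (j + u).choose u * (a + j + u).choose (j + u) =
        (a + j).choose j * (a + j + u).choose (a + j) := by
      have h := Nat.choose_mul (n := a + j + u) (k := j + u) (s := j) (by omega)
      have h' := Nat.choose_mul (n := a + j + u) (k := a + j) (s := j) (by omega)
      rw [← Nat.choose_symm_add, mul_comm, h, mul_comm, mul_comm ((a + j).choose j), h', mul_comm,
        Nat.add_sub_cancel_left, Nat.add_sub_cancel, show a + j + u - j = a + u by omega,
        Nat.choose_symm_add]
    have : ((j + u).choose u * (a + j + u).choose (j + u) : ℤ) =
        (a + j).choose j * (a + j + u).choose (a + j) := by exact_mod_cast this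
    linear_combination n.choose (j + u) * (a + n).choose (2 * n - j - u) * this
  rw [hL, hR, mul_assoc]
  congr 1
  norm_cast
  have h₁ := choose_mul_sum_left n a j hj
  have h₂ := choose_mul_sum_right n a j hj
  generalize ∑ i ∈ Finset.range (n + 1),
    n.choose i * a.choose i * (a + 2 * n - i).choose (a + j) = L at *
  generalize ∑ u ∈ Finset.range (n - j + 1),
      n.choose (j + u) * (a + j + u).choose (a + j) * (a + n).choose (2 * n - j - u) = R at *
  generalize ∑ s ∈ Finset.range (n + 1),
    n.choose s * a.choose s * (2 * n - j + s).choose (n - j) = T at *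
  suffices h : (2 * n - j).choose n * L = (2 * n).choose n * R by
    rw [mul_left_comm, h, mul_left_comm]
  qify at h₁ h₂ ⊢
  rw [Nat.cast_choose ℚ (show n ≤ 2 * n - j by omega), Nat.cast_choose ℚ (show n ≤ a + n by omega),
    show a + n - n = a by omega, show 2 * n - j - n = n - j by omega] at h₁
  rw [Nat.cast_choose ℚ (show n ≤ 2 * n - j by omega),
    Nat.cast_choose ℚ (show n - j ≤ a + n by omega), show 2 * n - j - n = n - j by omega,
    show a + n - (n - j) = a + j by omega] at h₂
  rw [Nat.cast_choose ℚ (show n ≤ 2 * n - j by omega), Nat.cast_choose ℚ (show n ≤ 2 * n by omega),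
    show 2 * n - j - n = n - j by omega, show 2 * n - n = n by omega]
  field_simp at h₁ h₂ ⊢
  apply mul_left_cancel₀ (a := ((a + j).factorial * (2 * n - j).factorial : ℚ)) (by positivity)
  linear_combination (n.factorial : ℚ) * h₁ - (n - j).factorial * (2 * n).factorial * h₂
end

section
/- Let n ≥ 1 and l ≥ 1 be natural numbers, let j be a non-negative integer with j ≤ n, and let m be a natural number with m ≥ l*n. Then Schr(n,m,j,l), the number of lattice paths from (0,0) to (n,m) using steps (1,0), (0,1) and (1,1) that never go below the line y = l*x and have exactly j steps of the form (1,0), satisfies n * Schr(n,m,j,l) = (m-l*n+1) * binom(n,j) * binom(m+j,n-1). -/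
/-- A valid step of a lattice path: `(1,0)`, `(0,1)` or `(1,1)`. -/
def IsStep (s : ℕ × ℕ) : Prop := s = (1, 0) ∨ s = (0, 1) ∨ s = (1, 1)

/-- `schr a b slope j` is the number of lattice paths (encoded as lists of steps,
read left to right) from `(0,0)` to `(a,b)` using steps `(1,0)`, `(0,1)`, `(1,1)`,
that never go below the line `y = slope * x` (i.e. every partial sum `(x,y)`
satisfies `y ≥ slope * x`), and that use exactly `j` steps of the form `(1,0)`. -/
noncomputable def schr (a b slope j : ℕ) : ℕ :=
  Set.ncard {l : List (ℕ × ℕ) |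
    (∀ s ∈ l, IsStep s) ∧
    (l.map Prod.fst).sum = a ∧
    (l.map Prod.snd).sum = b ∧
    (∀ p : List (ℕ × ℕ), p <+: l →
      slope * (p.map Prod.fst).sum ≤ (p.map Prod.snd).sum) ∧
    l.count (1, 0) = j}

/-- The set of paths counted by `schr a b slope j`. -/
def schrPaths (slope a b j : ℕ) : Set (List (ℕ × ℕ)) :=
  {l : List (ℕ × ℕ) |
    (∀ s ∈ l, IsStep s) ∧
    (l.map Prod.fst).sum = a ∧
    (l.map Prod.snd).sum = b ∧
    (∀ p : List (ℕ × ℕ), p <+: l →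
      slope * (p.map Prod.fst).sum ≤ (p.map Prod.snd).sum) ∧
    l.count (1, 0) = j}

theorem schrPaths_eq_empty {slope a b : ℕ} (j : ℕ) (h : b < slope * a) :
    schrPaths slope a b j = ∅ := by
  ext q
  simp only [Set.mem_empty_iff_false, iff_false]
  rintro ⟨-, h1, h2, h3, -⟩
  have := h3 q List.prefix_rfl
  rw [h1, h2] at this
  omega

theorem nil_mem_schrPaths {slope a b j : ℕ} :
    [] ∈ schrPaths slope a b j ↔ a = 0 ∧ b = 0 ∧ j = 0 := by
  simp only [schrPaths, Set.mem_ofPred_eq, List.prefix_nil]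
  constructor
  · rintro ⟨-, h1, h2, -, h3⟩
    simp_all
  · rintro ⟨rfl, rfl, rfl⟩
    simp

/-- A path ends with the step `s` exactly when removing `s` leaves a path to the
accordingly shifted endpoint. -/
theorem concat_mem_schrPaths {slope a b j : ℕ} (h : slope * a ≤ b)
    (p : List (ℕ × ℕ)) (s : ℕ × ℕ) :
    p ++ [s] ∈ schrPaths slope a b j ↔
      IsStep s ∧ ∃ a' b' j', a = a' + s.1 ∧ b = b' + s.2 ∧
        j = j' + (if s = (1, 0) then 1 else 0) ∧ p ∈ schrPaths slope a' b' j' := by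
  simp only [schrPaths, Set.mem_ofPred_eq, List.prefix_concat_iff, List.count_append,
    List.count_singleton, List.map_append, List.sum_append, List.map_cons, List.map_nil,
    List.sum_singleton, List.mem_append, List.mem_singleton]
  constructor
  · rintro ⟨h1, h2, h3, h4, h5⟩
    refine ⟨h1 s (Or.inr rfl), _, _, _, h2.symm, h3.symm, ?_,
      fun t ht => h1 t (Or.inl ht), rfl, rfl, fun q hq => h4 q (Or.inr hq), rfl⟩
    simpa using h5.symm
  · rintro ⟨hs, a', b', j', rfl, rfl, rfl, h1, h2, h3, h4, h5⟩
    refine ⟨?_, by rw [h2], by rw [h3], ?_, ?_⟩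
    · rintro t (ht | rfl)
      exacts [h1 t ht, hs]
    · rintro q (rfl | hq)
      · simpa [h2, h3] using h
      · exact h4 q hq
    · simp [h5]

theorem concat_injective {α : Type*} (s : α) :
    Function.Injective fun p : List α => p ++ [s] :=
  fun _ _ h => List.append_cancel_right h

theorem schrPaths_zero_zero (slope j : ℕ) :
    schrPaths slope 0 0 j = if j = 0 then {[]} else ∅ := by
  ext q
  rcases List.eq_nil_or_concat q with rfl | ⟨p, s, rfl⟩
  · rw [nil_mem_schrPaths]
    split_ifs <;> simp_all
  · rw [List.concat_eq_append, concat_mem_schrPaths (by simp)]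
    have : ¬ (IsStep s ∧ ∃ a' b' j', 0 = a' + s.1 ∧ 0 = b' + s.2 ∧
        j = j' + (if s = (1, 0) then 1 else 0) ∧ p ∈ schrPaths slope a' b' j') := by
      rintro ⟨rfl | rfl | rfl, a', b', j', h1, h2, -⟩ <;> simp at h1 h2
    simp only [this, false_iff]
    split_ifs <;> simp

theorem schrPaths_zero_succ (slope b j : ℕ) :
    schrPaths slope 0 (b + 1) j = (· ++ [(0, 1)]) '' schrPaths slope 0 b j := by
  ext q
  rcases List.eq_nil_or_concat q with rfl | ⟨p, s, rfl⟩
  · simp [nil_mem_schrPaths]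
  · rw [List.concat_eq_append, concat_mem_schrPaths (by simp)]
    constructor
    · rintro ⟨rfl | rfl | rfl, a', b', j', h1, h2, h3, h4⟩
      · simp at h1
      · simp at h1 h2 h3
        subst h1 h2 h3
        exact ⟨p, h4, rfl⟩
      · simp at h1
    · rintro ⟨p', h, he⟩
      obtain ⟨rfl, hs⟩ := List.append_inj' he rfl
      obtain rfl : (0, 1) = s := by simpa using hs
      exact ⟨Or.inr (Or.inl rfl), 0, b, j, by simp, by simp, by simp, h⟩

theorem schrPaths_succ_succ_zero {slope a b : ℕ} (h : slope * (a + 1) ≤ b + 1) :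
    schrPaths slope (a + 1) (b + 1) 0 =
      (· ++ [(0, 1)]) '' schrPaths slope (a + 1) b 0 ∪
      (· ++ [(1, 1)]) '' schrPaths slope a b 0 := by
  ext q
  rcases List.eq_nil_or_concat q with rfl | ⟨p, s, rfl⟩
  · simp [nil_mem_schrPaths]
  · rw [List.concat_eq_append, concat_mem_schrPaths h]
    constructor
    · rintro ⟨rfl | rfl | rfl, a', b', j', h1, h2, h3, h4⟩
      · simp at h3
      · simp at h1 h2 h3
        subst h1 h2 h3
        exact Or.inl ⟨p, h4, rfl⟩
      · simp at h1 h2 h3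
        subst h1 h2 h3
        exact Or.inr ⟨p, h4, rfl⟩
    · rintro (⟨p', h, he⟩ | ⟨p', h, he⟩) <;> obtain ⟨rfl, hs⟩ := List.append_inj' he rfl
      · obtain rfl : (0, 1) = s := by simpa using hs
        exact ⟨Or.inr (Or.inl rfl), a + 1, b, 0, by simp, by simp, by simp, h⟩
      · obtain rfl : (1, 1) = s := by simpa using hs
        exact ⟨Or.inr (Or.inr rfl), a, b, 0, by simp, by simp, by simp, h⟩

theorem schrPaths_succ_succ_succ {slope a b : ℕ} (j : ℕ) (h : slope * (a + 1) ≤ b + 1) :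
    schrPaths slope (a + 1) (b + 1) (j + 1) =
      ((· ++ [(1, 0)]) '' schrPaths slope a (b + 1) j ∪
      (· ++ [(0, 1)]) '' schrPaths slope (a + 1) b (j + 1)) ∪
      (· ++ [(1, 1)]) '' schrPaths slope a b (j + 1) := by
  ext q
  rcases List.eq_nil_or_concat q with rfl | ⟨p, s, rfl⟩
  · simp [nil_mem_schrPaths]
  · rw [List.concat_eq_append, concat_mem_schrPaths h]
    constructor
    · rintro ⟨rfl | rfl | rfl, a', b', j', h1, h2, h3, h4⟩
      · simp at h1 h2 h3
        subst h1 h2 h3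
        exact Or.inl (Or.inl ⟨p, h4, rfl⟩)
      · simp at h1 h2 h3
        subst h1 h2 h3
        exact Or.inl (Or.inr ⟨p, h4, rfl⟩)
      · simp at h1 h2 h3
        subst h1 h2 h3
        exact Or.inr ⟨p, h4, rfl⟩
    · rintro ((⟨p', h, he⟩ | ⟨p', h, he⟩) | ⟨p', h, he⟩) <;>
        obtain ⟨rfl, hs⟩ := List.append_inj' he rfl
      · obtain rfl : (1, 0) = s := by simpa using hs
        exact ⟨Or.inl rfl, a, b + 1, j, by simp, by simp, by simp, h⟩
      · obtain rfl : (0, 1) = s := by simpa using hs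
        exact ⟨Or.inr (Or.inl rfl), a + 1, b, j + 1, by simp, by simp, by simp, h⟩
      · obtain rfl : (1, 1) = s := by simpa using hs
        exact ⟨Or.inr (Or.inr rfl), a, b, j + 1, by simp, by simp, by simp, h⟩

theorem disjoint_image_concat {α : Type*} {s t : α} (hst : s ≠ t) (A B : Set (List α)) :
    Disjoint ((· ++ [s]) '' A) ((· ++ [t]) '' B) := by
  rw [Set.disjoint_left]
  rintro _ ⟨p, -, rfl⟩ ⟨q, -, he⟩
  have := (List.append_inj' he rfl).2
  simp_all

theorem encard_schrPaths_zero (slope b j : ℕ) :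
    (schrPaths slope 0 b j).encard = ((if j = 0 then 1 else 0 : ℕ) : ℕ∞) := by
  induction b with
  | zero => rw [schrPaths_zero_zero]; split_ifs <;> simp
  | succ b ih => rw [schrPaths_zero_succ, (concat_injective _).encard_image, ih]

theorem encard_schrPaths_succ_succ_zero {slope a b : ℕ} (h : slope * (a + 1) ≤ b + 1) :
    (schrPaths slope (a + 1) (b + 1) 0).encard =
      (schrPaths slope (a + 1) b 0).encard + (schrPaths slope a b 0).encard := by
  rw [schrPaths_succ_succ_zero h, Set.encard_union_eq (disjoint_image_concat (by simp) _ _),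
    (concat_injective _).encard_image, (concat_injective _).encard_image]

theorem encard_schrPaths_succ_succ_succ {slope a b : ℕ} (j : ℕ)
    (h : slope * (a + 1) ≤ b + 1) :
    (schrPaths slope (a + 1) (b + 1) (j + 1)).encard =
      (schrPaths slope a (b + 1) j).encard + (schrPaths slope (a + 1) b (j + 1)).encard +
        (schrPaths slope a b (j + 1)).encard := by
  rw [schrPaths_succ_succ_succ j h, Set.encard_union_eq, Set.encard_union_eq,
    (concat_injective _).encard_image, (concat_injective _).encard_image,
    (concat_injective _).encard_image]
  · exact disjoint_image_concat (by simp) _ _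
  · exact Set.disjoint_union_left.2
      ⟨disjoint_image_concat (by simp) _ _, disjoint_image_concat (by simp) _ _⟩

/-- The closed formula, also valid one unit below the boundary line, where it gives zero. -/
theorem exists_encard_schrPaths {slope : ℕ} (hs : 1 ≤ slope) (a b j : ℕ) :
    ∃ k : ℕ, (schrPaths slope (a + 1) b j).encard = k ∧
      (slope * (a + 1) ≤ b + 1 → ((a + 1 : ℕ) : ℤ) * k =
        ((b : ℤ) - slope * (a + 1) + 1) * (a + 1).choose j * (b + j).choose a) := by
  induction a generalizing b j with
  | zero =>
    induction b generalizing j with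
    | zero =>
      refine ⟨0, by rw [schrPaths_eq_empty j (by omega)]; simp, fun h => ?_⟩
      obtain rfl : slope = 1 := by omega
      simp
    | succ b ih =>
      by_cases h : slope * (0 + 1) ≤ b + 1
      · rcases j with _ | j
        · obtain ⟨k, hk, hk'⟩ := ih 0
          refine ⟨k + 1, ?_, fun _ => ?_⟩
          · rw [encard_schrPaths_succ_succ_zero h, hk, encard_schrPaths_zero]
            simp
          · have := hk' h
            push_cast at this ⊢
            simp at this ⊢
            linarith
        · obtain ⟨k, hk, hk'⟩ := ih (j + 1)
          refine ⟨(if j = 0 then 1 else 0) + k, ?_, fun _ => ?_⟩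
          · rw [encard_schrPaths_succ_succ_succ j h, hk, encard_schrPaths_zero,
              encard_schrPaths_zero]
            simp
          · have := hk' h
            rcases j with _ | j
            · push_cast at this ⊢
              simp at this ⊢
              linarith
            · simpa [Nat.choose_eq_zero_of_lt (show 1 < j + 1 + 1 by omega)] using this
      · refine ⟨0, by rw [schrPaths_eq_empty j (by omega)]; simp, fun h' => ?_⟩
        obtain rfl : slope = b + 2 := by omega
        push_cast
        ring
  | succ a iha =>
    induction b generalizing j with
    | zero =>
      have : a + 1 + 1 ≤ slope * (a + 1 + 1) := Nat.le_mul_of_pos_left _ hs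
      exact ⟨0, by rw [schrPaths_eq_empty j (by omega)]; simp, fun h => by omega⟩
    | succ b ih =>
      by_cases h : slope * (a + 1 + 1) ≤ b + 1
      · have h1 : slope * (a + 1) ≤ b + 1 :=
          le_trans (Nat.mul_le_mul_left _ (by omega)) h
        have ha : ((a : ℤ) + 1) ≠ 0 := by positivity
        rcases j with _ | j
        · obtain ⟨k2, hk2, e2⟩ := ih 0
          obtain ⟨k3, hk3, e3⟩ := iha b 0
          refine ⟨k2 + k3, ?_, fun _ => ?_⟩
          · rw [encard_schrPaths_succ_succ_zero h, hk2, hk3]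
            simp
          · have e2 := e2 h
            have e3 := e3 h1
            have hU : ((b : ℤ) + 1) * b.choose a = (b.choose a + b.choose (a + 1)) * (a + 1) := by
              exact_mod_cast (Nat.choose_succ_succ b a) ▸ Nat.add_one_mul_choose_eq b a
            have hc : (((b + 1).choose (a + 1) : ℕ) : ℤ) = b.choose a + b.choose (a + 1) := by
              exact_mod_cast Nat.choose_succ_succ b a
            simp only [Nat.choose_zero_right, add_zero] at e2 e3 ⊢
            rw [hc]
            generalize ((b.choose a : ℕ) : ℤ) = U at *
            generalize ((b.choose (a + 1) : ℕ) : ℤ) = V at *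
            push_cast at e2 e3 ⊢
            apply mul_left_cancel₀ ha
            linear_combination (a + 1 : ℤ) * e2 + (a + 2 : ℤ) * e3 + hU
        · obtain ⟨k1, hk1, e1⟩ := iha (b + 1) j
          obtain ⟨k2, hk2, e2⟩ := ih (j + 1)
          obtain ⟨k3, hk3, e3⟩ := iha b (j + 1)
          refine ⟨k1 + k2 + k3, ?_, fun _ => ?_⟩
          · rw [encard_schrPaths_succ_succ_succ j h, hk1, hk2, hk3]
            simp
          · have e1 := e1 (by omega)
            have e2 := e2 h
            have e3 := e3 h1
            obtain ⟨M, hM⟩ : ∃ M, M = b + j + 1 := ⟨_, rfl⟩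
            rw [show b + 1 + j = M by omega] at e1
            rw [show b + (j + 1) = M by omega] at e2 e3
            rw [show b + 1 + (j + 1) = M + 1 by omega]
            have hU : ((M : ℤ) + 1) * M.choose a = (M.choose a + M.choose (a + 1)) * (a + 1) := by
              exact_mod_cast (Nat.choose_succ_succ M a) ▸ Nat.add_one_mul_choose_eq M a
            have hX : ((a : ℤ) + 1 + 1) * (a + 1).choose j =
                ((a + 1).choose j + (a + 1).choose (j + 1)) * (j + 1) := by
              exact_mod_cast (Nat.choose_succ_succ (a + 1) j) ▸
                Nat.add_one_mul_choose_eq (a + 1) j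
            have hc : (((M + 1).choose (a + 1) : ℕ) : ℤ) = M.choose a + M.choose (a + 1) := by
              exact_mod_cast Nat.choose_succ_succ M a
            have hd : (((a + 1 + 1).choose (j + 1) : ℕ) : ℤ) =
                (a + 1).choose j + (a + 1).choose (j + 1) := by
              exact_mod_cast Nat.choose_succ_succ (a + 1) j
            have hM' : (M : ℤ) = b + j + 1 := by exact_mod_cast hM
            rw [hd] at e2 ⊢
            rw [hc]
            rw [hM'] at hU
            generalize ((M.choose a : ℕ) : ℤ) = U at *
            generalize ((M.choose (a + 1) : ℕ) : ℤ) = V at *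
            generalize (((a + 1).choose j : ℕ) : ℤ) = X at *
            generalize (((a + 1).choose (j + 1) : ℕ) : ℤ) = Y at *
            push_cast at e1 e2 e3 ⊢
            apply mul_left_cancel₀ ha
            linear_combination (a + 2 : ℤ) * e1 + (a + 1 : ℤ) * e2 + (a + 2 : ℤ) * e3 +
              (X + Y) * hU + U * hX
      · refine ⟨0, by rw [schrPaths_eq_empty j (by omega)]; simp, fun h' => ?_⟩
        have : (slope : ℤ) * (a + 1 + 1) = b + 2 := by
          exact_mod_cast (show slope * (a + 1 + 1) = b + 2 by omega)
        push_cast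
        rw [this]
        ring

theorem stmt19 (n l j m : ℕ) (hn : 1 ≤ n) (hl : 1 ≤ l) (hj : j ≤ n)
    (hm : l * n ≤ m) :
    n * schr n m l j = (m - l * n + 1) * n.choose j * (m + j).choose (n - 1) := by
  obtain ⟨a, rfl⟩ : ∃ a, n = a + 1 := ⟨n - 1, by omega⟩
  obtain ⟨k, hk, h⟩ := exists_encard_schrPaths hl a m j
  have hs : schr (a + 1) m l j = k := by
    change (schrPaths l (a + 1) m j).ncard = k
    rw [Set.ncard_def, hk, ENat.toNat_natCast]
  rw [hs, Nat.add_sub_cancel]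
  zify [hm]
  have := h (by omega)
  push_cast at this
  exact this
end
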